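/- Let u = (0,1), let m be the minimum cardinality of a cover, and suppose Z ⊆ ℤ²∖H_u is a set of minimum cardinality among sets satisfying both |Z| < s² + s + m and Z̄ = [H_u ∪ Z]∖H_u infinite (for the update family 𝒰_S). Suppose p ∈ ℤ²∖H_u satisfies p + W ⊆ Z. Then every point q ∈ Z̄∖Z has the same y-coordinate as p. -/

import Mathlib

open scoped Classical

/-- A site of the two-dimensional lattice. -/
abbrev Site : Type := ℤ × ℤ

/-- An update family: a finite nonempty collection of finite nonempty rules,
none containing the origin. We represent the collection as a `Finset (Finset Site)`
together with this well-formedness predicate. -/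
def IsUpdateFamily (𝒰 : Finset (Finset Site)) : Prop :=
  𝒰.Nonempty ∧ ∀ U ∈ 𝒰, U.Nonempty ∧ ((0, 0) : Site) ∉ U

/-- One step of the bootstrap percolation dynamics. -/
def bpStep (𝒰 : Finset (Finset Site)) (A : Set Site) : Set Site :=
  A ∪ {x : Site | ∃ U ∈ 𝒰, ∀ y ∈ U, x + y ∈ A}

/-- The configuration after `t` steps of the dynamics started from `A`. -/
def bpIter (𝒰 : Finset (Finset Site)) (A : Set Site) : ℕ → Set Site
  | 0 => A
  | n + 1 => bpStep 𝒰 (bpIter 𝒰 A n)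

/-- The closure `[A]` of a set `A` under the bootstrap dynamics. -/
def bpClosure (𝒰 : Finset (Finset Site)) (A : Set Site) : Set Site :=
  ⋃ n : ℕ, bpIter 𝒰 A n

/-- The unit circle `S¹ ⊆ ℝ²`. -/
def sphere2 : Set (ℝ × ℝ) := {u : ℝ × ℝ | u.1 ^ 2 + u.2 ^ 2 = 1}

/-- Inner product of a lattice site with a real vector. -/
def inner2 (x : Site) (u : ℝ × ℝ) : ℝ := (x.1 : ℝ) * u.1 + (x.2 : ℝ) * u.2

/-- The open half-plane `H_u` with outer normal `u`. -/
def halfPlane (u : ℝ × ℝ) : Set Site := {x : Site | inner2 x u < 0}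

/-- The lattice line `l_u` through the origin perpendicular to `u`. -/
def lineu (u : ℝ × ℝ) : Set Site := {x : Site | inner2 x u = 0}

/-- A direction `u` is unstable if some rule lies in `H_u`. -/
def Unstable (𝒰 : Finset (Finset Site)) (u : ℝ × ℝ) : Prop :=
  ∃ U ∈ 𝒰, (U : Set Site) ⊆ halfPlane u

/-- A direction of the unit circle is stable if it is not unstable. -/
def Stable (𝒰 : Finset (Finset Site)) (u : ℝ × ℝ) : Prop :=
  u ∈ sphere2 ∧ ¬ Unstable 𝒰 u

/-- The set of stable directions. -/
def stableSet (𝒰 : Finset (Finset Site)) : Set (ℝ × ℝ) := {u | Stable 𝒰 u}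

/-- An isolated stable direction: a stable direction not in the (topological)
closure of the set of other stable directions. -/
def IsolatedStable (𝒰 : Finset (Finset Site)) (u : ℝ × ℝ) : Prop :=
  Stable 𝒰 u ∧ u ∉ closure (stableSet 𝒰 \ {u})

/-- The open semicircle of the unit circle centred at the direction `v`. -/
def openSemicircle (v : ℝ × ℝ) : Set (ℝ × ℝ) :=
  {u ∈ sphere2 | 0 < u.1 * v.1 + u.2 * v.2}

/-- A family is supercritical if some open semicircle consists of unstable directions. -/
def Supercritical (𝒰 : Finset (Finset Site)) : Prop :=
  ∃ v ∈ sphere2, ∀ u ∈ openSemicircle v, Unstable 𝒰 u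

/-- A family is critical if it is not supercritical and some open semicircle
contains only finitely many stable directions. -/
def Critical (𝒰 : Finset (Finset Site)) : Prop :=
  ¬ Supercritical 𝒰 ∧ ∃ v ∈ sphere2, (stableSet 𝒰 ∩ openSemicircle v).Finite

/-- The difficulty `α(u)` of a direction: `0` for unstable directions, `∞` for
non-isolated stable directions, and for isolated stable directions the minimum
cardinality of a finite `Z ⊆ ℤ² ∖ H_u` such that `[H_u ∪ Z] ∖ H_u` is infinite. -/
noncomputable def dirDifficulty (𝒰 : Finset (Finset Site)) (u : ℝ × ℝ) : ℕ∞ :=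
  if Unstable 𝒰 u then 0
  else if IsolatedStable 𝒰 u then
    sInf {n : ℕ∞ | ∃ Z : Finset Site, (∀ z ∈ Z, z ∉ halfPlane u) ∧
      (bpClosure 𝒰 (halfPlane u ∪ (Z : Set Site)) \ halfPlane u).Infinite ∧ n = Z.card}
  else ⊤

/-- The difficulty `α(𝒰)` of an update family. -/
noncomputable def difficulty (𝒰 : Finset (Finset Site)) : ℕ∞ :=
  ⨅ v ∈ sphere2, ⨆ u ∈ openSemicircle v, dirDifficulty 𝒰 u

/-- The diameter `D` of an update family: `2 · max{‖x‖_∞ : x ∈ ⋃ U ∈ 𝒰, U}`. -/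
def famDiam (𝒰 : Finset (Finset Site)) : ℕ :=
  2 * 𝒰.sup (fun U => U.sup (fun x => max x.1.natAbs x.2.natAbs))

/-- The set `W = {(x,0) : 1 ≤ x ≤ s²} ∪ {(l·s,1) : 1 ≤ l ≤ s}`. -/
noncomputable def Wset (s : ℕ) : Finset Site :=
  (Finset.Icc 1 (s ^ 2)).image (fun x => ((x : ℤ), (0 : ℤ))) ∪
    (Finset.Icc 1 s).image (fun l => (((l * s : ℕ) : ℤ), (1 : ℤ)))

/-- The set `T = {(0,−y) : 1 ≤ y ≤ N·s²}`. -/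
noncomputable def Tset (N s : ℕ) : Finset Site :=
  (Finset.Icc 1 (N * s ^ 2)).image (fun y => ((0 : ℤ), -(y : ℤ)))

/-- The rule `U₀ = {(−k,0) : 1 ≤ k ≤ N·s²} ∪ {(0,−k) : 1 ≤ k ≤ N·s²}`. -/
noncomputable def Urule0 (N s : ℕ) : Finset Site :=
  (Finset.Icc 1 (N * s ^ 2)).image (fun k => (-(k : ℤ), (0 : ℤ))) ∪
    (Finset.Icc 1 (N * s ^ 2)).image (fun k => ((0 : ℤ), -(k : ℤ)))

/-- The rule `U₁ = {(k,0) : 1 ≤ k ≤ N·s²} ∪ {(0,−k) : 1 ≤ k ≤ N·s²}`. -/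
noncomputable def Urule1 (N s : ℕ) : Finset Site :=
  (Finset.Icc 1 (N * s ^ 2)).image (fun k => ((k : ℤ), (0 : ℤ))) ∪
    (Finset.Icc 1 (N * s ^ 2)).image (fun k => ((0 : ℤ), -(k : ℤ)))

/-- The rule `U_{i,j}^k = T ∪ ((W ∪ {(i·s,2)}) − (k+(N+j)·s², 0))`. -/
noncomputable def Uijk (N s i j k : ℕ) : Finset Site :=
  Tset N s ∪
    (Wset s ∪ {(((i * s : ℕ) : ℤ), (2 : ℤ))}).image
      (fun w => w - (((k + (N + j) * s ^ 2 : ℕ) : ℤ), (0 : ℤ)))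

/-- The update family `𝒰_S = {U₀,U₁} ∪ {U_{i,j}^k : 1 ≤ i ≤ s, j ∈ S_i, 1 ≤ k ≤ s²}`
associated to a set cover instance `S`. -/
noncomputable def famS (N s : ℕ) (S : ℕ → Finset ℕ) : Finset (Finset Site) :=
  {Urule0 N s, Urule1 N s} ∪
    (((Finset.Icc 1 s ×ˢ Finset.Icc 1 N ×ˢ Finset.Icc 1 (s ^ 2)).filter
        (fun t => t.2.1 ∈ S t.1)).image (fun t => Uijk N s t.1 t.2.1 t.2.2))

/-- `M` is a cover of the set cover instance `S_1, …, S_s` over `{1,…,N}`. -/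
def IsCover (N s : ℕ) (S : ℕ → Finset ℕ) (M : Finset ℕ) : Prop :=
  M ⊆ Finset.Icc 1 s ∧ M.biUnion S = Finset.Icc 1 N

theorem not_mem_halfPlane_up_iff (x : Site) :
    x ∉ halfPlane ((0 : ℝ), (1 : ℝ)) ↔ 0 ≤ x.2 := by
  simp [halfPlane, inner2]

theorem mem_Icc_natCast_iff (n : ℕ) (x : ℤ) :
    (x ∈ (do let a ← Finset.Icc 1 n; pure (a : ℤ) : Finset ℤ)) ↔
      ∃ k ∈ Finset.Icc 1 n, (k : ℤ) = x := by
  simp [Finset.bind_def, eq_comm]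

theorem segment_mem_Wset {s k : ℕ} (hk : k ∈ Finset.Icc 1 (s ^ 2)) :
    (((k : ℤ), 0) : Site) ∈ Wset s :=
  Finset.mem_union_left _ (Finset.mem_image_of_mem _ ((mem_Icc_natCast_iff _ _).2 ⟨k, hk, rfl⟩))

/-- Every rule of the family contains `s²` consecutive sites of the horizontal axis. -/
theorem exists_segment_of_mem_famS {N s : ℕ} (hN : 1 ≤ N) {S : ℕ → Finset ℕ}
    {U : Finset Site} (hU : U ∈ famS N s S) :
    ∃ c : ℤ, ∀ k ∈ Finset.Icc 1 (s ^ 2), ((c + (k : ℤ), 0) : Site) ∈ U := by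
  have hle : s ^ 2 ≤ N * s ^ 2 := Nat.le_mul_of_pos_left _ hN
  simp only [famS, Finset.mem_union, Finset.mem_insert, Finset.mem_singleton,
    Finset.mem_image] at hU
  rcases hU with (rfl | rfl) | ⟨t, -, rfl⟩
  · refine ⟨-((s ^ 2 + 1 : ℕ) : ℤ), fun k hk => ?_⟩
    rw [Finset.mem_Icc] at hk
    refine Finset.mem_union_left _ (Finset.mem_image.2 ⟨((s ^ 2 + 1 - k : ℕ) : ℤ), ?_, ?_⟩)
    · refine (mem_Icc_natCast_iff _ _).2 ⟨_, ?_, rfl⟩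
      rw [Finset.mem_Icc]; omega
    · rw [Nat.cast_sub (by omega)]
      ext
      · ring
      · rfl
  · refine ⟨0, fun k hk => ?_⟩
    rw [Finset.mem_Icc] at hk
    refine Finset.mem_union_left _ (Finset.mem_image.2 ⟨k, ?_, by simp⟩)
    refine (mem_Icc_natCast_iff _ _).2 ⟨k, ?_, rfl⟩
    rw [Finset.mem_Icc]; omega
  · refine ⟨-((t.2.2 + (N + t.2.1) * s ^ 2 : ℕ) : ℤ), fun k hk => ?_⟩
    refine Finset.mem_union_right _ (Finset.mem_image.2 ⟨((k : ℤ), 0), ?_, ?_⟩)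
    · exact Finset.mem_union_left _ (segment_mem_Wset hk)
    · ext
      · simp only [Prod.fst_sub]; ring
      · simp

/-- If the sites of `Z` off the row `b` do not contain `s²` consecutive sites of a row,
then the dynamics started from `H_u ∪ Z` only ever infects sites of the row `b`. -/
theorem bpIter_famS_subset_row {N s : ℕ} (hN : 1 ≤ N) {S : ℕ → Finset ℕ} {Z : Finset Site}
    {b : ℤ} (hrow : ∀ h c : ℤ, h ≠ b → ∃ k ∈ Finset.Icc 1 (s ^ 2), ((c + (k : ℤ), h) : Site) ∉ Z)
    (n : ℕ) :
    ∀ q ∈ bpIter (famS N s S) (halfPlane ((0 : ℝ), (1 : ℝ)) ∪ (Z : Set Site)) n,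
      q ∉ halfPlane ((0 : ℝ), (1 : ℝ)) → q ∉ Z → q.2 = b := by
  induction n with
  | zero =>
    intro q hq hqH hqZ
    exact absurd hq (not_or.2 ⟨hqH, hqZ⟩)
  | succ n ih =>
    rintro q (hq | ⟨U, hU, hq⟩) hqH hqZ
    · exact ih q hq hqH hqZ
    · by_contra hb
      obtain ⟨c, hc⟩ := exists_segment_of_mem_famS hN hU
      obtain ⟨k, hk, hkZ⟩ := hrow q.2 (q.1 + c) hb
      have hsite : q + ((c + (k : ℤ), 0) : Site) = (q.1 + c + (k : ℤ), q.2) := by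
        ext <;> simp [add_assoc]
      have hinf := hq _ (hc k hk)
      rw [hsite] at hinf
      refine hb (ih (q.1 + c + (k : ℤ), q.2) hinf ?_ hkZ)
      rw [not_mem_halfPlane_up_iff] at hqH ⊢
      exact hqH

/-- The segment of sites `(c + k, h)`, `1 ≤ k ≤ n`, has `n` elements. -/
theorem card_image_segment (n : ℕ) (c h : ℤ) :
    ((Finset.Icc 1 n).image (fun k : ℕ => ((c + (k : ℤ), h) : Site))).card = n := by
  rw [Finset.card_image_of_injective, Nat.card_Icc, Nat.add_sub_cancel]
  intro a b hab
  simpa using hab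

/-- let `u = (0,1)`, `m` the minimum size of a cover, and `Z` a
set of minimum cardinality among sets `Z' ⊆ ℤ² ∖ H_u` with `|Z'| < s² + s + m`
and `Z̄'` infinite.  If `p + W ⊆ Z` for some `p ∈ ℤ² ∖ H_u`, then every
`q ∈ Z̄ ∖ Z` has the same `y`-coordinate as `p`. -/
theorem famS_same_row (N s : ℕ) (hN : 4 ≤ N) (hs : 4 ≤ s)
    (S : ℕ → Finset ℕ) (hS : ∀ i ∈ Finset.Icc 1 s, S i ⊆ Finset.Icc 1 N)
    (hcov : (Finset.Icc 1 s).biUnion S = Finset.Icc 1 N)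
    (m : ℕ) (hm : ∃ M : Finset ℕ, IsCover N s S M ∧ M.card = m)
    (hmin : ∀ M : Finset ℕ, IsCover N s S M → m ≤ M.card)
    (Z : Finset Site) (hZ : ∀ z ∈ Z, z ∉ halfPlane ((0 : ℝ), (1 : ℝ)))
    (hZcard : Z.card < s ^ 2 + s + m)
    (hZinf : (bpClosure (famS N s S) (halfPlane ((0 : ℝ), (1 : ℝ)) ∪ (Z : Set Site))
        \ halfPlane ((0 : ℝ), (1 : ℝ))).Infinite)
    (hZmin : ∀ Z' : Finset Site, (∀ z ∈ Z', z ∉ halfPlane ((0 : ℝ), (1 : ℝ))) →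
      Z'.card < s ^ 2 + s + m →
      (bpClosure (famS N s S) (halfPlane ((0 : ℝ), (1 : ℝ)) ∪ (Z' : Set Site))
        \ halfPlane ((0 : ℝ), (1 : ℝ))).Infinite → Z.card ≤ Z'.card)
    (p : Site) (hp : p ∉ halfPlane ((0 : ℝ), (1 : ℝ)))
    (hpW : ∀ w ∈ Wset s, p + w ∈ Z) :
    ∀ q ∈ (bpClosure (famS N s S) (halfPlane ((0 : ℝ), (1 : ℝ)) ∪ (Z : Set Site))
        \ halfPlane ((0 : ℝ), (1 : ℝ))) \ (Z : Set Site),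
      q.2 = p.2 := by
  have hms : m ≤ s := by
    simpa using hmin (Finset.Icc 1 s) ⟨subset_rfl, hcov⟩
  have hrow : ∀ h c : ℤ, h ≠ p.2 →
      ∃ k ∈ Finset.Icc 1 (s ^ 2), ((c + (k : ℤ), h) : Site) ∉ Z := by
    intro h c hh
    by_contra! hseg
    let L := (Finset.Icc 1 (s ^ 2)).image (fun k : ℕ => ((c + (k : ℤ), h) : Site))
    let P := (Finset.Icc 1 (s ^ 2)).image (fun k : ℕ => ((p.1 + (k : ℤ), p.2) : Site))
    have hdisj : Disjoint L P := by
      rw [Finset.disjoint_left]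
      intro x hxL hxP
      obtain ⟨a, -, rfl⟩ := Finset.mem_image.1 hxL
      obtain ⟨b, -, hb⟩ := Finset.mem_image.1 hxP
      exact hh (congrArg Prod.snd hb).symm
    have hsub : L ∪ P ⊆ Z := by
      refine Finset.union_subset (Finset.image_subset_iff.2 hseg)
        (Finset.image_subset_iff.2 fun k hk => ?_)
      have hkW := hpW _ (segment_mem_Wset hk)
      simpa [Prod.add_def] using hkW
    have hcard := Finset.card_le_card hsub
    rw [Finset.card_union_of_disjoint hdisj, card_image_segment, card_image_segment] at hcard
    nlinarith
  rintro q ⟨⟨hq, hqH⟩, hqZ⟩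
  obtain ⟨n, hn⟩ := Set.mem_iUnion.1 hq
  exact bpIter_famS_subset_row (by omega) hrow n q hn hqH hqZ
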